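/- (Symmetry of the resultant.) If σ is a permutation of {0, ..., n} and F_0, ..., F_n ∈ ℂ[x_0,...,x_n] are homogeneous of degrees d_0, ..., d_n, then Res(F_{σ(0)}, ..., F_{σ(n)}) = sign(σ)^{d_0 ⋯ d_n} · Res(F_0, ..., F_n). -/

import Mathlib

open MvPolynomial

/-- `Mono m e` is the type of exponent vectors of total degree `e` in `m` variables. -/
abbrev Mono (m e : ℕ) : Type := {α : Fin m → ℕ // ∑ j, α j = e}

instance (m e : ℕ) : Fintype (Mono m e) :=
  Fintype.subtype (Finset.Nat.antidiagonalTuple m e) fun _ => Finset.Nat.mem_antidiagonalTuple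

/-- The exponent vector as a finitely supported function (a monomial of `MvPolynomial`). -/
noncomputable abbrev Mono.toFinsupp {m e : ℕ} (α : Mono m e) : Fin m →₀ ℕ :=
  Finsupp.equivFunOnFinite.symm α.1

/-- The index type for the variables `u_{i,α}` of the universal ring of coefficients
`ℤ[u_{i,α} : i, |α| = d i]` for `m` forms of degrees `d 0, …, d (m-1)` in `m` variables. -/
abbrev CoeffIdx (m : ℕ) (d : Fin m → ℕ) : Type := Σ i : Fin m, Mono m (d i)

/-- Evaluation `P ↦ P(F_0, …, F_{m-1})` : each universal variable `u_{i,α}` is replaced by the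
corresponding coefficient `c_{i,α}` of `F_i`. -/
noncomputable def resEval {m : ℕ} (d : Fin m → ℕ) (F : Fin m → MvPolynomial (Fin m) ℂ)
    (R : MvPolynomial (CoeffIdx m d) ℤ) : ℂ :=
  eval₂ (Int.castRingHom ℂ) (fun v => coeff v.2.toFinsupp (F v.1)) R

/-- `IsResultant m d R` says that `R` is *the* resultant polynomial `Res_{d_0,…,d_n}` (`m = n+1`):
(1) for homogeneous `F_i` of degrees `d i`, the system `F_0 = ⋯ = F_n = 0` has a nontrivial
solution over `ℂ` iff `R(F_0,…,F_n) = 0`; (2) `R` is irreducible, even over `ℂ`;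
(3) `R(x_0^{d_0},…,x_n^{d_n}) = 1`. -/
def IsResultant (m : ℕ) (d : Fin m → ℕ) (R : MvPolynomial (CoeffIdx m d) ℤ) : Prop :=
  (∀ F : Fin m → MvPolynomial (Fin m) ℂ, (∀ i, (F i).IsHomogeneous (d i)) →
    ((∃ x : Fin m → ℂ, x ≠ 0 ∧ ∀ i, eval x (F i) = 0) ↔ resEval d F R = 0)) ∧
  Irreducible R ∧ Irreducible (MvPolynomial.map (Int.castRingHom ℂ) R) ∧
  resEval d (fun i => X i ^ d i) R = 1

/-- Over an algebraically closed field, an irreducible polynomial divides every polynomial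
vanishing on its zero set. -/
theorem dvd_of_irreducible_of_zeros {ι : Type*} [Finite ι] {P Q : MvPolynomial ι ℂ}
    (hP : Irreducible P) (h : ∀ u : ι → ℂ, eval u P = 0 → eval u Q = 0) : P ∣ Q := by
  have hprime : (Ideal.span {P}).IsPrime :=
    (Ideal.span_singleton_prime hP.ne_zero).2 hP.prime
  have hQ : Q ∈ vanishingIdeal ℂ (zeroLocus ℂ (Ideal.span {P})) := by
    intro u hu
    have := hu P (Ideal.mem_span_singleton_self P)
    rw [aeval_eq_eval] at this ⊢
    exact h u this
  rw [vanishingIdeal_zeroLocus_eq_radical, hprime.radical, Ideal.mem_span_singleton] at hQ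
  exact hQ

section Weighted

variable {ι : Type*} (w : ι → ℕ)

/-- The substitution `X v ↦ t ^ w v * X v` recording the weight as the degree in `t`. -/
noncomputable def weightExpand : MvPolynomial ι ℂ →ₐ[ℂ] Polynomial (MvPolynomial ι ℂ) :=
  aeval fun v => Polynomial.X ^ w v * Polynomial.C (X v)

theorem weightExpand_monomial (s : ι →₀ ℕ) (a : ℂ) :
    weightExpand w (monomial s a) = Polynomial.monomial (Finsupp.weight w s) (monomial s a) := by
  rw [weightExpand, aeval_monomial, Finsupp.weight_apply]
  simp only [mul_pow, ← pow_mul, Finsupp.prod_mul, smul_eq_mul]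
  rw [← Polynomial.C_mul_X_pow_eq_monomial, monomial_eq (a := a), map_mul,
    Finsupp.prod, Finsupp.prod, Finset.prod_pow_eq_pow_sum, Finsupp.sum, Finsupp.prod, map_prod]
  simp only [map_pow, mul_comm (w _)]
  rw [show algebraMap ℂ (Polynomial (MvPolynomial ι ℂ)) a = Polynomial.C (C a) from rfl]
  ring

theorem coeff_weightExpand (P : MvPolynomial ι ℂ) (n : ℕ) :
    (weightExpand w P).coeff n = weightedHomogeneousComponent w n P := by
  classical
  induction P using MvPolynomial.induction_on' with
  | monomial s a =>
    rw [weightExpand_monomial, Polynomial.coeff_monomial]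
    ext t
    rw [coeff_weightedHomogeneousComponent]
    split_ifs with h1 h2 h2
    · rfl
    · rw [coeff_monomial, if_neg]; rintro rfl; exact h2 h1
    · rw [coeff_monomial, if_neg, coeff_zero]; rintro rfl; exact h1 h2
    · rw [coeff_zero]
  | add p q hp hq => rw [map_add, Polynomial.coeff_add, hp, hq, map_add]

/-- A factor of a nonzero weighted homogeneous polynomial is weighted homogeneous. -/
theorem exists_isWeightedHomogeneous_of_dvd {P Q : MvPolynomial ι ℂ} {n : ℕ} (hQ0 : Q ≠ 0)
    (hQ : IsWeightedHomogeneous w Q n) (hPQ : P ∣ Q) :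
    ∃ e ≤ n, IsWeightedHomogeneous w P e := by
  obtain ⟨S, rfl⟩ := hPQ
  have hcoeff : ∀ T : MvPolynomial ι ℂ, IsWeightedHomogeneous w T n →
      weightExpand w T = Polynomial.monomial n T := by
    intro T hT
    ext1 k
    rw [coeff_weightExpand, weightedHomogeneousComponent_of_mem
      ((mem_weightedHomogeneousSubmodule ..).2 hT), Polynomial.coeff_monomial]
    simp only [eq_comm]
  have hne : ∀ T : MvPolynomial ι ℂ, T ≠ 0 → weightExpand w T ≠ 0 := by
    intro T hT h0
    apply hT
    rw [← sum_weightedHomogeneousComponent w T]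
    apply finsum_eq_zero_of_forall_eq_zero
    intro k
    rw [← coeff_weightExpand, h0, Polynomial.coeff_zero]
  have hP0 := hne P (left_ne_zero_of_mul hQ0)
  have hS0 := hne S (right_ne_zero_of_mul hQ0)
  have hmul := hcoeff _ hQ
  rw [map_mul] at hmul
  have h1 := congrArg Polynomial.natDegree hmul
  have h2 := congrArg Polynomial.natTrailingDegree hmul
  rw [Polynomial.natDegree_mul hP0 hS0, Polynomial.natDegree_monomial_eq _ hQ0] at h1
  rw [Polynomial.natTrailingDegree_mul hP0 hS0, Polynomial.natTrailingDegree_monomial hQ0] at h2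
  have h3 := (weightExpand w P).natTrailingDegree_le_natDegree
  have h4 := (weightExpand w S).natTrailingDegree_le_natDegree
  refine ⟨(weightExpand w P).natDegree, by omega, ?_⟩
  intro s hs
  by_contra hne'
  apply hs
  have hk : (weightExpand w P).coeff (Finsupp.weight w s) = 0 := by
    rcases lt_or_gt_of_ne hne' with h | h
    · exact Polynomial.coeff_eq_zero_of_lt_natTrailingDegree (by omega)
    · exact Polynomial.coeff_eq_zero_of_natDegree_lt h
  rw [coeff_weightExpand] at hk
  have := congrArg (coeff s) hk
  rwa [coeff_weightedHomogeneousComponent, if_pos rfl, coeff_zero] at this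

theorem eval_smul_of_isWeightedHomogeneous {P : MvPolynomial ι ℂ} {e : ℕ}
    (hP : IsWeightedHomogeneous w P e) (c : ℂ) (u : ι → ℂ) :
    eval (fun v => c ^ w v * u v) P = c ^ e * eval u P := by
  rw [eval_eq, eval_eq, Finset.mul_sum]
  refine Finset.sum_congr rfl fun s hs => ?_
  have hw := hP (mem_support_iff.1 hs)
  rw [Finsupp.weight_apply, Finsupp.sum] at hw
  simp only [smul_eq_mul] at hw
  rw [← hw, ← Finset.prod_pow_eq_pow_sum]
  simp only [mul_pow, Finset.prod_mul_distrib, ← pow_mul, mul_comm (w _)]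
  ring

theorem natDegree_aeval_le_of_isWeightedHomogeneous {P : MvPolynomial ι ℂ} {e : ℕ}
    (hP : IsWeightedHomogeneous w P e) (g : ι → Polynomial ℂ) (hg : ∀ v, (g v).natDegree ≤ w v) :
    (aeval g P).natDegree ≤ e := by
  rw [aeval_def, eval₂_eq]
  refine Polynomial.natDegree_sum_le_of_forall_le _ _ fun s hs => ?_
  have hw := hP (mem_support_iff.1 hs)
  rw [Finsupp.weight_apply, Finsupp.sum] at hw
  rw [← hw, Polynomial.algebraMap_eq]
  refine (Polynomial.natDegree_C_mul_le _ _).trans ((Polynomial.natDegree_prod_le _ _).trans ?_)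
  exact Finset.sum_le_sum fun v _ =>
    Polynomial.natDegree_pow_le.trans (Nat.mul_le_mul_left _ (hg v))

end Weighted

section GenericForms

variable {m : ℕ} {d : Fin m → ℕ} {K L : Type*} [CommRing K] [CommRing L]

/-- The form of degree `d j` with prescribed coefficients. -/
noncomputable def formOf (u : CoeffIdx m d → K) (j : Fin m) : MvPolynomial (Fin m) K :=
  ∑ γ : Mono m (d j), monomial γ.toFinsupp (u ⟨j, γ⟩)

theorem Mono.toFinsupp_injective {e : ℕ} :
    Function.Injective (Mono.toFinsupp : Mono m e → Fin m →₀ ℕ) :=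
  Finsupp.equivFunOnFinite.symm.injective.comp Subtype.val_injective

theorem Mono.degree_toFinsupp {e : ℕ} (γ : Mono m e) : γ.toFinsupp.degree = e := by
  rw [Finsupp.degree_eq_sum]; exact γ.2

theorem Mono.exists_toFinsupp_eq {e : ℕ} {s : Fin m →₀ ℕ} (hs : s.degree = e) :
    ∃ γ : Mono m e, γ.toFinsupp = s :=
  ⟨⟨s, by rw [← hs, Finsupp.degree_eq_sum]⟩, by ext; rfl⟩

theorem formOf_isHomogeneous (u : CoeffIdx m d → K) (j : Fin m) :
    (formOf u j).IsHomogeneous (d j) :=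
  IsHomogeneous.sum _ _ _ fun γ _ => isHomogeneous_monomial _ γ.degree_toFinsupp

theorem coeff_formOf (u : CoeffIdx m d → K) (v : CoeffIdx m d) :
    coeff v.2.toFinsupp (formOf u v.1) = u v := by
  classical
  rw [formOf, coeff_sum, Finset.sum_eq_single v.2]
  · rw [coeff_monomial, if_pos rfl]
  · intro γ _ hγ
    rw [coeff_monomial, if_neg fun h => hγ (Mono.toFinsupp_injective h)]
  · intro h; exact absurd (Finset.mem_univ _) h

theorem map_formOf (φ : K →+* L) (u : CoeffIdx m d → K) (j : Fin m) :
    map φ (formOf u j) = formOf (fun v => φ (u v)) j := by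
  simp only [formOf, map_sum, map_monomial]

theorem formOf_coeff {F : Fin m → MvPolynomial (Fin m) K}
    (hF : ∀ j, (F j).IsHomogeneous (d j)) :
    formOf (d := d) (fun v => coeff v.2.toFinsupp (F v.1)) = F := by
  funext j
  ext s
  by_cases hs : s.degree = d j
  · obtain ⟨γ, rfl⟩ := Mono.exists_toFinsupp_eq hs
    exact coeff_formOf _ (⟨j, γ⟩ : CoeffIdx m d)
  · rw [(formOf_isHomogeneous _ j).coeff_eq_zero hs, (hF j).coeff_eq_zero hs]

theorem eval_eq_sum_mono {e : ℕ} {G : MvPolynomial (Fin m) K} (hG : G.IsHomogeneous e)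
    (x : Fin m → K) : eval x G = ∑ β : Mono m e, coeff β.toFinsupp G * ∏ k, x k ^ β.1 k := by
  have h : G = ∑ β : Mono m e, monomial β.toFinsupp (coeff β.toFinsupp G) := by
    classical
    ext t
    rw [coeff_sum]
    simp only [coeff_monomial]
    by_cases ht : t.degree = e
    · obtain ⟨γ, rfl⟩ := Mono.exists_toFinsupp_eq ht
      simp [Mono.toFinsupp_injective.eq_iff]
    · rw [hG.coeff_eq_zero ht, Finset.sum_eq_zero]
      intro β _
      rw [if_neg]
      rintro rfl
      exact ht β.degree_toFinsupp
  conv_lhs => rw [h]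
  rw [map_sum]
  refine Finset.sum_congr rfl fun β _ => ?_
  rw [eval_monomial, Finsupp.prod_fintype _ _ fun _ => pow_zero _]
  rfl

theorem resEval_eq (F : Fin m → MvPolynomial (Fin m) ℂ) (R : MvPolynomial (CoeffIdx m d) ℤ) :
    resEval d F R =
      eval (fun v => coeff v.2.toFinsupp (F v.1)) (map (Int.castRingHom ℂ) R) := by
  rw [resEval, eval_map]

theorem IsResultant.eval_eq_zero_iff {R : MvPolynomial (CoeffIdx m d) ℤ}
    (hR : IsResultant m d R) (u : CoeffIdx m d → ℂ) :
    eval u (map (Int.castRingHom ℂ) R) = 0 ↔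
      ∃ x : Fin m → ℂ, x ≠ 0 ∧ ∀ j, eval x (formOf u j) = 0 := by
  rw [hR.1 _ (formOf_isHomogeneous u), resEval_eq]
  simp only [coeff_formOf]

end GenericForms

section Macaulay

variable {m s : ℕ} {K L : Type*} [CommRing K] [CommRing L]

/-- The Macaulay matrix: the row indexed by `α` lists the coefficients of
`x ^ α / x_j ^ d_j * F j`, where `j = c α`. -/
noncomputable def macaulayMatrix (d : Fin m → ℕ) (c : Mono m s → Fin m)
    (F : Fin m → MvPolynomial (Fin m) K) : Matrix (Mono m s) (Mono m s) K :=
  Matrix.of fun α β => coeff β.toFinsupp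
    (monomial (α.toFinsupp - Finsupp.single (c α) (d (c α))) 1 * F (c α))

variable {d : Fin m → ℕ} {c : Mono m s → Fin m}

theorem map_macaulayMatrix (φ : K →+* L) (F : Fin m → MvPolynomial (Fin m) K) :
    (macaulayMatrix d c F).map φ = macaulayMatrix d c fun j => map φ (F j) := by
  ext α β
  simp only [macaulayMatrix, Matrix.map_apply, Matrix.of_apply]
  rw [← coeff_map, map_mul, map_monomial, map_one]

theorem macaulayMatrix_X_pow (hc : ∀ α, d (c α) ≤ α.1 (c α)) :
    macaulayMatrix d c (fun j => (X j ^ d j : MvPolynomial (Fin m) K)) = 1 := by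
  classical
  ext α β
  have hle : Finsupp.single (c α) (d (c α)) ≤ α.toFinsupp := by
    rw [Finsupp.single_le_iff]; exact hc α
  rw [macaulayMatrix, Matrix.of_apply, X_pow_eq_monomial, monomial_mul, tsub_add_cancel_of_le hle,
    coeff_monomial, mul_one, Matrix.one_apply]
  simp only [Mono.toFinsupp_injective.eq_iff]

theorem det_macaulayMatrix_eq_zero {F : Fin m → MvPolynomial (Fin m) ℂ}
    (hF : ∀ j, (F j).IsHomogeneous (d j)) (hc : ∀ α, d (c α) ≤ α.1 (c α))
    {x : Fin m → ℂ} (hx : x ≠ 0) (hFx : ∀ j, eval x (F j) = 0) :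
    (macaulayMatrix d c F).det = 0 := by
  classical
  rw [← Matrix.exists_mulVec_eq_zero_iff]
  refine ⟨fun β => ∏ k, x k ^ β.1 k, ?_, ?_⟩
  · obtain ⟨k, hk⟩ := Function.ne_iff.1 hx
    intro h0
    have := congrFun h0 ⟨Pi.single k s, by simp⟩
    refine absurd this (Finset.prod_ne_zero_iff.2 fun l _ => ?_)
    by_cases hl : l = k
    · subst hl; exact pow_ne_zero _ hk
    · simp [Pi.single_eq_of_ne hl]
  · funext α
    have hle : Finsupp.single (c α) (d (c α)) ≤ α.toFinsupp := by
      rw [Finsupp.single_le_iff]; exact hc α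
    have hdeg : (α.toFinsupp - Finsupp.single (c α) (d (c α))).degree + d (c α) = s := by
      have := congrArg Finsupp.degree (tsub_add_cancel_of_le hle)
      rwa [map_add, Finsupp.degree_single, α.degree_toFinsupp] at this
    have hhom := (isHomogeneous_monomial (R := ℂ) 1 (rfl :
      (α.toFinsupp - Finsupp.single (c α) (d (c α))).degree = _)).mul (hF (c α))
    rw [hdeg] at hhom
    have := eval_eq_sum_mono hhom x
    rw [map_mul, hFx, mul_zero] at this
    rw [Pi.zero_apply, this]
    rfl

/-- The weight counting the variables of the `i`-th form. -/
def blockWeight (d : Fin m → ℕ) (i : Fin m) (v : CoeffIdx m d) : ℕ := if v.1 = i then 1 else 0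

theorem det_macaulayMatrix_isWeightedHomogeneous (i : Fin m) :
    IsWeightedHomogeneous (blockWeight d i)
      (macaulayMatrix d c (formOf (X : CoeffIdx m d → MvPolynomial _ ℂ))).det
      (∑ α : Mono m s, if c α = i then 1 else 0) := by
  classical
  rw [Matrix.det_apply]
  refine IsWeightedHomogeneous.sum _ _ _ fun τ _ => ?_
  have key : IsWeightedHomogeneous (blockWeight d i)
      (∏ α, macaulayMatrix d c (formOf (X : CoeffIdx m d → MvPolynomial _ ℂ)) (τ α) α)
      (∑ α : Mono m s, if c α = i then 1 else 0) := by
    rw [← Equiv.sum_comp τ]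
    refine IsWeightedHomogeneous.prod _ _ _ fun α _ => ?_
    rw [macaulayMatrix, Matrix.of_apply, coeff_monomial_mul']
    split_ifs with h1 h2 h2
    all_goals first | exact isWeightedHomogeneous_zero _ _ _ | skip
    all_goals
      rw [one_mul, formOf, coeff_sum]
      refine IsWeightedHomogeneous.sum _ _ _ fun γ _ => ?_
      rw [coeff_monomial]
      split_ifs
      · convert isWeightedHomogeneous_X ℂ (blockWeight d i) _
        simp [blockWeight, h2]
      · exact isWeightedHomogeneous_zero _ _ _
  rcases Int.units_eq_one_or (Equiv.Perm.sign τ) with h | h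
  · rwa [h, one_smul]
  · rw [h, Units.neg_smul, one_smul]; exact key.neg

end Macaulay

section BlockDegree

variable {m : ℕ} {d : Fin m → ℕ} {R : MvPolynomial (CoeffIdx m d) ℤ}

/-- The resultant is homogeneous in the coefficients of each form, of degree at most the product
of the degrees of the other forms: it divides a Macaulay determinant. -/
theorem IsResultant.exists_isWeightedHomogeneous (hR : IsResultant m d R) (i : Fin m) :
    ∃ e ≤ ∏ j, Function.update d i 1 j,
      IsWeightedHomogeneous (blockWeight d i) (map (Int.castRingHom ℂ) R) e := by
  classical
  set s := ∑ j, (d j - 1) + 1 with hs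
  let c : Mono m s → Fin m := fun α => if h : ∃ j, j ≠ i ∧ d j ≤ α.1 j then h.choose else i
  have hc : ∀ α, d (c α) ≤ α.1 (c α) := by
    intro α
    by_cases h : ∃ j, j ≠ i ∧ d j ≤ α.1 j
    · simp only [c, dif_pos h]
      exact h.choose_spec.2
    · simp only [c, dif_neg h]
      push Not at h
      have h1 : ∑ j ∈ Finset.univ.erase i, α.1 j ≤ ∑ j ∈ Finset.univ.erase i, (d j - 1) :=
        Finset.sum_le_sum fun j hj => Nat.le_sub_one_of_lt (h j (Finset.ne_of_mem_erase hj))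
      have h2 := Finset.add_sum_erase Finset.univ α.1 (Finset.mem_univ i)
      have h3 := Finset.add_sum_erase Finset.univ (fun j => d j - 1) (Finset.mem_univ i)
      have h4 := α.2
      omega
  have hci : ∀ α, c α = i → ∀ j, j ≠ i → α.1 j < d j := by
    intro α hα j hj
    by_contra hlt
    have h : ∃ j, j ≠ i ∧ d j ≤ α.1 j := ⟨j, hj, not_lt.1 hlt⟩
    simp only [c, dif_pos h] at hα
    exact h.choose_spec.1 hα
  set M : MvPolynomial (CoeffIdx m d) ℂ := (macaulayMatrix d c (formOf X)).det with hM
  have hevalM : ∀ u, eval u M = (macaulayMatrix d c (formOf u)).det := by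
    intro u
    rw [hM, RingHom.map_det, RingHom.mapMatrix_apply, map_macaulayMatrix]
    simp only [map_formOf, eval_X]
  have hM0 : M ≠ 0 := by
    intro h0
    have := hevalM (fun v => coeff v.2.toFinsupp (X v.1 ^ d v.1 : MvPolynomial (Fin m) ℂ))
    rw [formOf_coeff (F := fun j => X j ^ d j) fun j => isHomogeneous_X_pow j (d j),
      macaulayMatrix_X_pow hc, Matrix.det_one, h0, map_zero] at this
    exact zero_ne_one this
  have hdvd : map (Int.castRingHom ℂ) R ∣ M := by
    refine dvd_of_irreducible_of_zeros hR.2.2.1 fun u hu => ?_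
    obtain ⟨x, hx, hux⟩ := (hR.eval_eq_zero_iff u).1 hu
    rw [hevalM]
    exact det_macaulayMatrix_eq_zero (formOf_isHomogeneous u) hc hx hux
  obtain ⟨e, he, hRe⟩ := exists_isWeightedHomogeneous_of_dvd _ hM0
    (det_macaulayMatrix_isWeightedHomogeneous i) hdvd
  refine ⟨e, he.trans ?_, hRe⟩
  rw [Finset.sum_boole, Nat.cast_id]
  calc _ ≤ (Fintype.piFinset fun j => Finset.range (Function.update d i 1 j)).card := by
        refine Finset.card_le_card_of_injOn (fun α => Function.update α.1 i 0) ?_ ?_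
        · intro α hα
          have hα' := hci α (Finset.mem_filter.1 hα).2
          rw [Finset.mem_coe, Fintype.mem_piFinset]
          intro j
          rw [Finset.mem_range]
          by_cases hj : j = i
          · subst hj; simp
          · simpa [Function.update_of_ne hj] using hα' j hj
        · intro α _ β _ h
          have hne : ∀ j, j ≠ i → α.1 j = β.1 j := by
            intro j hj
            simpa [Function.update_of_ne hj] using congrFun h j
          apply Subtype.ext
          funext j
          by_cases hj : j = i
          · subst hj
            have h1 := Finset.add_sum_erase Finset.univ α.1 (Finset.mem_univ j)
            have h2 := Finset.add_sum_erase Finset.univ β.1 (Finset.mem_univ j)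
            have h3 : ∑ k ∈ Finset.univ.erase j, α.1 k = ∑ k ∈ Finset.univ.erase j, β.1 k :=
              Finset.sum_congr rfl fun k hk => hne k (Finset.ne_of_mem_erase hk)
            have h4 := α.2
            have h5 := β.2
            omega
          · exact hne j hj
    _ = _ := by rw [Fintype.card_piFinset]; simp only [Finset.card_range]

theorem eval_aeval_polynomial {ι : Type*} (P : MvPolynomial ι ℂ) (g : ι → Polynomial ℂ) (t : ℂ) :
    (aeval g P).eval t = eval (fun v => (g v).eval t) P := by
  have := comp_aeval_apply (f := g) (φ := Polynomial.aeval (R := ℂ) t) P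
  simpa only [Polynomial.coe_aeval_eq_eval, aeval_eq_eval] using this

/-- Lower bound for the degree of the resultant in the coefficients of one form, obtained by
specializing the other forms to products of linear forms with the maximal number of common
zeros. -/
theorem IsResultant.le_of_isWeightedHomogeneous (hR : IsResultant m d R) (hd : ∀ j, 0 < d j)
    (i : Fin m) {e : ℕ}
    (he : IsWeightedHomogeneous (blockWeight d i) (map (Int.castRingHom ℂ) R) e) :
    ∏ j, Function.update d i 1 j ≤ e := by
  classical
  set n := Function.update d i 1 with hn
  let w : Fin m → ℕ := fun j => ∏ k, n (Fin.castLE j.is_lt.le k)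
  let ℓ : MvPolynomial (Fin m) ℂ := ∑ j ∈ Finset.univ.erase i, X j
  let F : ℂ → Fin m → MvPolynomial (Fin m) ℂ := fun t j =>
    if j = i then C t * X i ^ d i - ℓ * X i ^ (d i - 1)
    else ∏ a ∈ Finset.range (d j), (X j - C ((a : ℂ) * w j) * X i)
  have hF : ∀ t j, (F t j).IsHomogeneous (d j) := by
    intro t j
    by_cases hj : j = i
    · subst hj
      simp only [F, if_pos]
      refine ((isHomogeneous_X_pow j (d j)).C_mul t).sub ?_
      have h1 : ℓ.IsHomogeneous 1 := IsHomogeneous.sum _ _ _ fun k _ => isHomogeneous_X ℂ k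
      have := h1.mul (isHomogeneous_X_pow (R := ℂ) j (d j - 1))
      rwa [Nat.add_sub_cancel' (hd j)] at this
    · simp only [F, if_neg hj]
      have := IsHomogeneous.prod (Finset.range (d j))
        (fun a : ℕ => X j - C ((a : ℂ) * w j) * X i) (fun _ => 1)
        fun a _ => (isHomogeneous_X ℂ j).sub ((isHomogeneous_X ℂ i).C_mul _)
      simpa using this
  let g : CoeffIdx m d → Polynomial ℂ := fun v =>
    if v.1 = i then Polynomial.X * Polynomial.C (coeff v.2.toFinsupp (X i ^ d i))
      - Polynomial.C (coeff v.2.toFinsupp (ℓ * X i ^ (d i - 1)))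
    else Polynomial.C (coeff v.2.toFinsupp (F 0 v.1))
  set p := aeval g (map (Int.castRingHom ℂ) R) with hp
  have hdeg : p.natDegree ≤ e := by
    refine natDegree_aeval_le_of_isWeightedHomogeneous _ he g fun v => ?_
    simp only [g, blockWeight]
    split_ifs
    · compute_degree
    · exact (Polynomial.natDegree_C _).le
  have hroot : ∀ t : ℂ, p.eval t = 0 ↔ ∃ x : Fin m → ℂ, x ≠ 0 ∧ ∀ j, eval x (F t j) = 0 := by
    intro t
    rw [hR.1 _ (hF t), resEval_eq, hp, eval_aeval_polynomial]
    have : (fun v => (g v).eval t) = fun v => coeff v.2.toFinsupp (F t v.1) := by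
      funext v
      simp only [g, F]
      split_ifs
      · rw [Polynomial.eval_sub, Polynomial.eval_mul, Polynomial.eval_X, Polynomial.eval_C,
          Polynomial.eval_C, coeff_sub, coeff_C_mul]
      · rw [Polynomial.eval_C]
    rw [this]
  have hsplit : ∀ f : (j : Fin m) → Fin (n j),
      ((finPiFinEquiv f : Fin _) : ℂ) = ∑ j ∈ Finset.univ.erase i, ((f j : ℕ) : ℂ) * w j := by
    intro f
    have hfi : (f i : ℕ) = 0 := by
      have := (f i).is_lt
      simp only [hn, Function.update_self] at this
      omega
    rw [finPiFinEquiv_apply, ← Finset.add_sum_erase _ _ (Finset.mem_univ i), hfi]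
    push_cast
    simp [w]
  have hzeros : ∀ N : Fin (∏ j, n j), p.eval ((N : ℕ) : ℂ) = 0 := by
    intro N
    obtain ⟨f, rfl⟩ := finPiFinEquiv.surjective N
    rw [hroot]
    refine ⟨fun j => if j = i then 1 else ((f j : ℕ) : ℂ) * w j,
      Function.ne_iff.2 ⟨i, by simp⟩, fun j => ?_⟩
    by_cases hj : j = i
    · simp only [F, if_pos hj, ℓ, map_sub, map_mul, eval_C, map_pow, eval_X, map_sum, one_pow,
        mul_one, if_true]
      rw [hsplit, sub_eq_zero]
      exact Finset.sum_congr rfl fun k hk => by rw [if_neg (Finset.ne_of_mem_erase hk)]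
    · simp only [F, if_neg hj, map_prod]
      refine Finset.prod_eq_zero (i := (f j : ℕ)) ?_ ?_
      · have := (f j).is_lt
        simp only [hn, Function.update_of_ne hj] at this
        exact Finset.mem_range.2 this
      · simp [hj]
  have hp0 : p ≠ 0 := by
    intro h0
    obtain ⟨x, hx, hFx⟩ := (hroot (-1)).1 (by rw [h0, Polynomial.eval_zero])
    have hlin : ∀ j, j ≠ i → ∃ a : ℕ, x j = (a : ℂ) * w j * x i := by
      intro j hj
      have := hFx j
      simp only [F, if_neg hj, map_prod, Finset.prod_eq_zero_iff] at this
      obtain ⟨a, -, ha⟩ := this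
      exact ⟨a, by simpa [sub_eq_zero] using ha⟩
    choose! a ha using hlin
    have hxi : x i ≠ 0 := by
      intro h
      apply hx
      funext j
      by_cases hj : j = i
      · rw [hj, h]; rfl
      · rw [ha j hj, h, mul_zero]; rfl
    have h1 := hFx i
    simp only [F, if_pos, ℓ, map_sub, map_mul, eval_C, map_pow, eval_X, map_sum] at h1
    rw [Finset.sum_congr rfl fun k hk => ha k (Finset.ne_of_mem_erase hk), ← Finset.sum_mul,
      ← Nat.sub_add_cancel (hd i), pow_succ, Nat.add_sub_cancel] at h1
    have h2 : (-1 - ∑ j ∈ Finset.univ.erase i, (a j : ℂ) * w j) * x i ^ (d i - 1) * x i = 0 := by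
      linear_combination h1
    rcases mul_eq_zero.1 h2 with h3 | h3
    · rcases mul_eq_zero.1 h3 with h4 | h4
      · have h5 : ((∑ j ∈ Finset.univ.erase i, a j * w j + 1 : ℕ) : ℂ) = 0 := by
          push_cast
          linear_combination -h4
        exact absurd h5 (Nat.cast_ne_zero.2 (Nat.succ_ne_zero _))
      · exact hxi (eq_zero_of_pow_eq_zero h4)
    · exact hxi h3
  refine le_trans ?_ hdeg
  have hcard := Polynomial.card_le_degree_of_subset_roots (p := p)
    (Z := Finset.univ.map ⟨fun N : Fin (∏ j, n j) => ((N : ℕ) : ℂ),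
      fun _ _ h => Fin.ext (Nat.cast_injective h)⟩) (by
      intro z hz
      obtain ⟨N, -, rfl⟩ := Finset.mem_map.1 (Finset.mem_def.2 hz)
      exact (Polynomial.mem_roots hp0).2 (hzeros N))
  simpa using hcard

/-- The resultant is homogeneous in the coefficients of each form, of degree the product of the
degrees of the other forms. -/
theorem IsResultant.isWeightedHomogeneous (hR : IsResultant m d R) (hd : ∀ j, 0 < d j)
    (i : Fin m) : IsWeightedHomogeneous (blockWeight d i) (map (Int.castRingHom ℂ) R)
      (∏ j, Function.update d i 1 j) := by
  obtain ⟨e, he, hRe⟩ := hR.exists_isWeightedHomogeneous i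
  rwa [he.antisymm (hR.le_of_isWeightedHomogeneous hd i hRe)] at hRe

/-- Scaling the forms by constants. -/
theorem IsResultant.eval_mul (hR : IsResultant m d R) (hd : ∀ j, 0 < d j) (c : Fin m → ℂ)
    (u : CoeffIdx m d → ℂ) :
    eval (fun v => c v.1 * u v) (map (Int.castRingHom ℂ) R) =
      (∏ i, c i ^ ∏ j, Function.update d i 1 j) * eval u (map (Int.castRingHom ℂ) R) := by
  classical
  have key : ∀ S : Finset (Fin m),
      eval (fun v => (∏ i ∈ S, c i ^ blockWeight d i v) * u v) (map (Int.castRingHom ℂ) R) =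
      (∏ i ∈ S, c i ^ ∏ j, Function.update d i 1 j) * eval u (map (Int.castRingHom ℂ) R) := by
    intro S
    induction S using Finset.induction_on with
    | empty => simp
    | insert i S hi ih =>
      simp only [Finset.prod_insert hi, mul_assoc]
      rw [eval_smul_of_isWeightedHomogeneous _ (hR.isWeightedHomogeneous hd i), ih]
  rw [← key Finset.univ]
  congr! 3 with v
  simp [blockWeight, pow_ite]

end BlockDegree

section LinearForms

variable {m : ℕ} {K L : Type*} [CommRing K] [CommRing L]

/-- The powers `(∑ k, A j k * x k) ^ d j` of the linear forms given by the rows of `A`. -/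
noncomputable def powForms (d : Fin m → ℕ) (A : Matrix (Fin m) (Fin m) K) (j : Fin m) :
    MvPolynomial (Fin m) K :=
  (∑ k, C (A j k) * X k) ^ d j

variable {d : Fin m → ℕ}

theorem powForms_isHomogeneous (A : Matrix (Fin m) (Fin m) K) (j : Fin m) :
    (powForms d A j).IsHomogeneous (d j) := by
  have h : (∑ k, C (A j k) * X k : MvPolynomial (Fin m) K).IsHomogeneous 1 :=
    IsHomogeneous.sum _ _ _ fun k _ => (isHomogeneous_X K k).C_mul _
  simpa [powForms] using h.pow (d j)

theorem map_powForms (φ : K →+* L) (A : Matrix (Fin m) (Fin m) K) (j : Fin m) :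
    map φ (powForms d A j) = powForms d (A.map φ) j := by
  simp [powForms]

theorem eval_powForms (A : Matrix (Fin m) (Fin m) K) (x : Fin m → K) (j : Fin m) :
    eval x (powForms d A j) = (A.mulVec x) j ^ d j := by
  simp [powForms, Matrix.mulVec, dotProduct]

theorem powForms_diagonal_mul (D : Fin m → K) (B : Matrix (Fin m) (Fin m) K) (j : Fin m) :
    powForms d (Matrix.diagonal D * B) j = C (D j ^ d j) * powForms d B j := by
  simp only [powForms, Matrix.diagonal_mul, map_mul, mul_assoc, ← Finset.mul_sum, mul_pow, map_pow]

theorem powForms_permMatrix (σ : Equiv.Perm (Fin m)) (j : Fin m) :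
    powForms d (σ.permMatrix K) j = X (σ j) ^ d j := by
  simp [powForms, PEquiv.toMatrix_apply]

variable {R : MvPolynomial (CoeffIdx m d) ℤ}

theorem IsResultant.resEval_powForms_eq_zero_iff (hR : IsResultant m d R) (hd : ∀ j, 0 < d j)
    (A : Matrix (Fin m) (Fin m) ℂ) : resEval d (powForms d A) R = 0 ↔ A.det = 0 := by
  rw [← hR.1 _ (powForms_isHomogeneous A), ← Matrix.exists_mulVec_eq_zero_iff]
  refine exists_congr fun x => and_congr_right fun _ => ?_
  rw [funext_iff]
  refine forall_congr' fun j => ?_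
  rw [eval_powForms, pow_eq_zero_iff (hd j).ne', Pi.zero_apply]

/-- Row operations do not change the resultant of powers of linear forms, since a polynomial in
one variable without zeros is constant. -/
theorem IsResultant.resEval_powForms_transvection_mul (hR : IsResultant m d R)
    (hd : ∀ j, 0 < d j) {a b : Fin m} (hab : a ≠ b) (t : ℂ) (B : Matrix (Fin m) (Fin m) ℂ) :
    resEval d (powForms d (Matrix.transvection a b t * B)) R = resEval d (powForms d B) R := by
  have hdet : ∀ r : ℂ, (Matrix.transvection a b r * B).det = B.det := fun r => by
    rw [Matrix.det_mul, Matrix.det_transvection_of_ne a b hab, one_mul]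
  by_cases hB : B.det = 0
  · rw [(hR.resEval_powForms_eq_zero_iff hd _).2 hB,
      (hR.resEval_powForms_eq_zero_iff hd _).2 ((hdet t).trans hB)]
  set p : Polynomial ℂ := aeval (fun v => coeff v.2.toFinsupp
    (powForms d (Matrix.transvection a b Polynomial.X * B.map Polynomial.C) v.1))
    (map (Int.castRingHom ℂ) R) with hp
  have hpeval : ∀ r : ℂ, p.eval r = resEval d (powForms d (Matrix.transvection a b r * B)) R := by
    intro r
    rw [hp, eval_aeval_polynomial, resEval_eq]
    congr! 3 with v
    rw [← Polynomial.coe_evalRingHom, ← coeff_map, map_powForms, Matrix.map_mul, Matrix.map_map]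
    congr 3
    · ext k l
      simp only [Matrix.transvection, Matrix.map_apply, Matrix.add_apply, Matrix.one_apply,
        Matrix.single_apply, map_add]
      split_ifs <;> simp
    · ext k l; simp
  have hdeg : p.degree = 0 := by
    by_contra h
    obtain ⟨r, hr⟩ := IsAlgClosed.exists_root p h
    rw [Polynomial.IsRoot, hpeval, hR.resEval_powForms_eq_zero_iff hd, hdet] at hr
    exact hB hr
  have h0 := hpeval 0
  rw [Matrix.transvection_zero, one_mul] at h0
  rw [← h0, ← hpeval t, Polynomial.eq_C_of_degree_eq_zero hdeg, Polynomial.eval_C,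
    Polynomial.eval_C]

/-- The resultant of powers of linear forms is a power of the determinant. -/
theorem IsResultant.resEval_powForms (hR : IsResultant m d R) (hd : ∀ j, 0 < d j)
    {A : Matrix (Fin m) (Fin m) ℂ} (hA : A.det ≠ 0) :
    resEval d (powForms d A) R = A.det ^ ∏ i, d i := by
  classical
  have key : ∀ B : Matrix (Fin m) (Fin m) ℂ,
      resEval d (powForms d (A * B)) R = A.det ^ (∏ i, d i) * resEval d (powForms d B) R := by
    refine Matrix.diagonal_transvection_induction_of_det_ne_zero
      (fun A => ∀ B : Matrix (Fin m) (Fin m) ℂ,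
        resEval d (powForms d (A * B)) R = A.det ^ (∏ i, d i) * resEval d (powForms d B) R)
      A hA ?_ ?_ ?_
    · intro D _ B
      rw [resEval_eq, resEval_eq]
      simp only [powForms_diagonal_mul, coeff_C_mul]
      rw [hR.eval_mul hd (fun j => D j ^ d j), Matrix.det_diagonal, ← Finset.prod_pow]
      congr! 2 with i
      rw [← pow_mul, Finset.prod_update_of_mem (Finset.mem_univ i), one_mul,
        Finset.sdiff_singleton_eq_erase, Finset.mul_prod_erase _ _ (Finset.mem_univ i)]
    · intro t B
      rw [t.det, one_pow, one_mul]
      exact hR.resEval_powForms_transvection_mul hd t.hij t.c B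
    · intro A B _ _ hA hB E
      rw [Matrix.mul_assoc, hA, hB, Matrix.det_mul, mul_pow, mul_assoc]
  have h1 : powForms d (1 : Matrix (Fin m) (Fin m) ℂ) = fun i => X i ^ d i := by
    funext j
    simp [powForms, Matrix.one_apply]
  have := key 1
  rwa [mul_one, h1, hR.2.2.2, mul_one] at this

end LinearForms

/-- Relabelling the forms, as a bijection of the variables of the universal coefficient rings. -/
def CoeffIdx.permute {m : ℕ} (d : Fin m → ℕ) (σ : Equiv.Perm (Fin m)) :
    CoeffIdx m (d ∘ σ) ≃ CoeffIdx m d :=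
  Equiv.sigmaCongrLeft (β := fun i => Mono m (d i)) σ

/-- Symmetry of the resultant: for a permutation `σ` of `{0,…,n}`,
`Res(F_{σ(0)},…,F_{σ(n)}) = sign(σ)^{d_0 ⋯ d_n} ⬝ Res(F_0,…,F_n)`. -/
theorem resultant_symmetry (n : ℕ) (d : Fin (n + 1) → ℕ) (hd : ∀ i, 0 < d i)
    (σ : Equiv.Perm (Fin (n + 1)))
    (R : MvPolynomial (CoeffIdx (n + 1) d) ℤ) (hR : IsResultant (n + 1) d R)
    (R' : MvPolynomial (CoeffIdx (n + 1) (d ∘ σ)) ℤ) (hR' : IsResultant (n + 1) (d ∘ σ) R')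
    (F : Fin (n + 1) → MvPolynomial (Fin (n + 1)) ℂ)
    (hF : ∀ i, (F i).IsHomogeneous (d i)) :
    resEval (d ∘ σ) (fun i => F (σ i)) R' =
      ((Equiv.Perm.sign σ : ℤ) : ℂ) ^ (∏ i, d i) * resEval d F R := by
  classical
  set P := map (Int.castRingHom ℂ) R with hP
  set Q := rename (CoeffIdx.permute d σ) (map (Int.castRingHom ℂ) R') with hQ
  have hd' : ∀ i, 0 < (d ∘ σ) i := fun i => hd (σ i)
  have hevalQ : ∀ G : Fin (n + 1) → MvPolynomial (Fin (n + 1)) ℂ,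
      eval (fun v => coeff v.2.toFinsupp (G v.1)) Q =
        resEval (d ∘ σ) (fun i => G (σ i)) R' := by
    intro G
    rw [hQ, eval_rename, resEval_eq]
    rfl
  have hzero : ∀ u, eval u P = 0 ↔ eval u Q = 0 := by
    intro u
    have hu : u = fun v => coeff v.2.toFinsupp (formOf u v.1) := by
      funext v; rw [coeff_formOf]
    rw [hP, hR.eval_eq_zero_iff, hu, hevalQ,
      ← hR'.1 (fun i => formOf u (σ i)) fun i => formOf_isHomogeneous u (σ i), ← hu]
    exact exists_congr fun x => and_congr_right fun _ =>
      (σ.forall_congr_right (q := fun j => eval x (formOf u j) = 0)).symm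
  have hQirr : Irreducible Q :=
    (MulEquiv.irreducible_iff (renameEquiv ℂ (CoeffIdx.permute d σ))).2 hR'.2.2.1
  obtain ⟨S, hS⟩ := dvd_of_irreducible_of_zeros hR.2.2.1 fun u => (hzero u).1
  have hSunit : IsUnit S := (hQirr.isUnit_or_isUnit hS).resolve_left hR.2.2.1.not_isUnit
  obtain ⟨c, -, rfl⟩ := isUnit_iff_eq_C_of_isReduced.1 hSunit
  have hG : ∀ G : Fin (n + 1) → MvPolynomial (Fin (n + 1)) ℂ,
      resEval (d ∘ σ) (fun i => G (σ i)) R' = c * resEval d G R := by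
    intro G
    rw [← hevalQ, hS, map_mul, eval_C, resEval_eq, mul_comm]
  rw [hG]
  congr 1
  have h1 := hG fun i => X i ^ d i
  have hdet : (σ.permMatrix ℂ).det = ((Equiv.Perm.sign σ : ℤ) : ℂ) := Matrix.det_permutation σ
  have hpow : (fun i => X (σ i) ^ d (σ i)) = powForms (d ∘ σ) (σ.permMatrix ℂ) := by
    funext j; rw [powForms_permMatrix]; rfl
  rw [hR.2.2.2, mul_one, hpow, hR'.resEval_powForms hd' (by rw [hdet]; simp), hdet] at h1
  rw [← h1]
  congr 1
  exact Equiv.prod_comp σ d
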